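/- Let (ℱ_t)_{t∈ℕ} be a filtration on (Ω, 𝒢, P) and ℱ_∞ := σ(∪_t ℱ_t). Let Q be a probability measure on (Ω, ℱ_∞) with Q ≪ P on ℱ_t for every t ∈ ℕ, with density process M_t := dQ/dP restricted to ℱ_t, and set M_∞ := limsup_{t→∞} M_t, a [0,∞]-valued ℱ_∞-measurable function (the limit of M_t exists P-a.s. and also Q-a.s. in [0,∞]). Let γ_∞ be a nonnegative ℱ_∞-measurable function with γ_∞ = 0 Q-a.s. on the event {M_∞ = ∞}. Then γ_∞ > 0 Q-a.s. if and only if Q ≪ P on ℱ_∞ and γ_∞ > 0 P-a.s. on the event {M_∞ > 0}. -/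

import Mathlib

open MeasureTheory Filter
open scoped Topology ENNReal

/-- If `u / (1 + u)` converges to `z`, then `z ∈ [0, 1]`, and the limit superior of `u` is `∞`
(resp. `0`) exactly when `z = 1` (resp. `z = 0`). -/
lemma limsup_ofReal_of_tendsto_div_one_add {u : ℕ → ℝ} (hu : ∀ t, 0 ≤ u t) {z : ℝ}
    (h : Tendsto (fun t => u t / (1 + u t)) atTop (𝓝 z)) :
    0 ≤ z ∧ z ≤ 1 ∧ (limsup (fun t => ENNReal.ofReal (u t)) atTop = ⊤ ↔ z = 1) ∧
      (limsup (fun t => ENNReal.ofReal (u t)) atTop = 0 ↔ z = 0) := by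
  have hpos : ∀ t, 0 < 1 + u t := fun t => by linarith [hu t]
  have hz0 : 0 ≤ z := ge_of_tendsto' h fun t => div_nonneg (hu t) (hpos t).le
  have hz1 : z ≤ 1 := le_of_tendsto' h fun t => by
    rw [div_le_one (hpos t)]; linarith
  have h' : Tendsto (fun t => 1 - u t / (1 + u t)) atTop (𝓝 (1 - z)) := h.const_sub 1
  have hinv : ∀ t, 1 - u t / (1 + u t) = (1 + u t)⁻¹ := fun t => by
    have := (hpos t).ne'
    field_simp
    ring
  simp only [hinv] at h'
  refine ⟨hz0, hz1, ?_⟩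
  rcases eq_or_lt_of_le hz1 with rfl | hlt
  · have h0 : Tendsto (fun t => (1 + u t)⁻¹) atTop (𝓝[>] 0) :=
      tendsto_nhdsWithin_iff.2 ⟨by simpa using h',
        Eventually.of_forall fun t => inv_pos.2 (hpos t)⟩
    have h1 : Tendsto (fun t => 1 + u t) atTop atTop := by
      simpa [Pi.inv_def] using h0.inv_tendsto_nhdsGT_zero
    have h2 : Tendsto u atTop atTop := by
      simpa using tendsto_atTop_add_const_left atTop (-1 : ℝ) h1
    have h3 := (ENNReal.tendsto_ofReal_atTop.comp h2).limsup_eq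
    simp only [Function.comp_def] at h3
    simp [h3]
  · have h1 : Tendsto (fun t => (1 + u t)⁻¹⁻¹ - 1) atTop (𝓝 ((1 - z)⁻¹ - 1)) :=
      (h'.inv₀ (by linarith)).sub_const 1
    have h2 : Tendsto u atTop (𝓝 ((1 - z)⁻¹ - 1)) := by simpa using h1
    have h3 := (ENNReal.tendsto_ofReal h2).limsup_eq
    refine ⟨?_, ?_⟩
    · simp [h3, hlt.ne]
    · rw [h3, ENNReal.ofReal_eq_zero, sub_nonpos, inv_le_one₀ (by linarith)]
      constructor <;> intro <;> linarith

/-- If `Q` has density `f` with respect to `P` on the sub-σ-algebra `m₀`, then on `m₀` it has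
density `f / (1 + f)` with respect to `P + Q`. -/
lemma setIntegral_div_one_add_eq {Ω : Type*} {m₀ m : MeasurableSpace Ω} (hm : m₀ ≤ m)
    (P Q : Measure Ω) [IsFiniteMeasure Q] {f : Ω → ℝ}
    (hf : Measurable[m₀] f) (hf0 : ∀ ω, 0 ≤ f ω) (hfi : Integrable f P)
    (hfd : ∀ A : Set Ω, MeasurableSet[m₀] A → ∫ ω in A, f ω ∂P = (Q A).toReal)
    {A : Set Ω} (hA : MeasurableSet[m₀] A) :
    ∫ ω in A, f ω / (1 + f ω) ∂(P + Q) = (Q A).toReal := by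
  have hlint : ∀ B : Set Ω, MeasurableSet[m₀] B → ∫⁻ ω in B, ENNReal.ofReal (f ω) ∂P = Q B := by
    intro B hB
    rw [← ofReal_integral_eq_lintegral_ofReal hfi.restrict (Eventually.of_forall hf0), hfd B hB,
      ENNReal.ofReal_toReal (measure_ne_top Q B)]
  have htrim : Q.trim hm = (P.withDensity fun ω => ENNReal.ofReal (f ω)).trim hm := by
    refine @Measure.ext _ m₀ _ _ fun B hB => ?_
    rw [trim_measurableSet_eq hm hB, trim_measurableSet_eq hm hB,
      withDensity_apply _ (hm B hB), hlint B hB]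
  have hg : Measurable[m₀] fun ω => ENNReal.ofReal (f ω / (1 + f ω)) :=
    (hf.div (hf.const_add 1)).ennreal_ofReal
  have hfm : Measurable f := hf.mono hm le_rfl
  have hgm : Measurable fun ω => ENNReal.ofReal (f ω / (1 + f ω)) := hg.mono hm le_rfl
  have hQ : ∫⁻ ω in A, ENNReal.ofReal (f ω / (1 + f ω)) ∂Q
      = ∫⁻ ω in A, ENNReal.ofReal (f ω) * ENNReal.ofReal (f ω / (1 + f ω)) ∂P := by
    rw [← lintegral_indicator (hm A hA), ← lintegral_trim hm (hg.indicator hA), htrim,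
      lintegral_trim hm (hg.indicator hA), lintegral_indicator (hm A hA),
      setLIntegral_withDensity_eq_setLIntegral_mul _ hfm.ennreal_ofReal hgm (hm A hA)]
    rfl
  have hpos : ∀ ω, 0 < 1 + f ω := fun ω => by linarith [hf0 ω]
  have hR : ∫⁻ ω in A, ENNReal.ofReal (f ω / (1 + f ω)) ∂(P + Q) = Q A := by
    rw [Measure.restrict_add, lintegral_add_measure, hQ, ← lintegral_add_left hgm, ← hlint A hA]
    refine lintegral_congr fun ω => ?_
    have h0 := div_nonneg (hf0 ω) (hpos ω).le
    rw [← ENNReal.ofReal_mul (hf0 ω), ← ENNReal.ofReal_add h0 (mul_nonneg (hf0 ω) h0)]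
    congr 1
    have := (hpos ω).ne'
    field_simp
  rw [integral_eq_lintegral_of_nonneg_ae
    (Eventually.of_forall fun ω => div_nonneg (hf0 ω) (hpos ω).le)
    (hfm.div (hfm.const_add 1)).aestronglyMeasurable, hR]

/-- For a density process `M` of `Q` with respect to `P`, the process `M / (1 + M)` converges
`(P + Q)`-a.e. to the density of `Q` with respect to `P + Q` on the limit σ-algebra. -/
lemma exists_density_tendsto_div_one_add {Ω : Type*} {m : MeasurableSpace Ω} (F : Filtration ℕ m)
    (P Q : Measure Ω) [IsFiniteMeasure P] [IsFiniteMeasure Q]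
    {M : ℕ → Ω → ℝ}
    (hM_meas : ∀ t, Measurable[F t] (M t)) (hM_nonneg : ∀ t ω, 0 ≤ M t ω)
    (hM_int : ∀ t, Integrable (M t) P)
    (hM_dens : ∀ t, ∀ A : Set Ω, MeasurableSet[F t] A →
      ∫ ω in A, M t ω ∂P = (Q A).toReal) :
    ∃ Z : Ω → ℝ, Integrable Z (P + Q) ∧
      (∀ A : Set Ω, MeasurableSet[⨆ t, (F t : MeasurableSpace Ω)] A →
        ∫ ω in A, Z ω ∂(P + Q) = (Q A).toReal) ∧
      ∀ᵐ ω ∂(P + Q), Tendsto (fun t => M t ω / (1 + M t ω)) atTop (𝓝 (Z ω)) := by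
  have hle : ⨆ t, (F t : MeasurableSpace Ω) ≤ m := iSup_le F.le
  have hac : Q ≪ P + Q := Measure.absolutelyContinuous_of_le (Measure.le_add_left le_rfl)
  set g : Ω → ℝ := fun ω => (Q.rnDeriv (P + Q) ω).toReal with hg
  have hgi : Integrable g (P + Q) := Measure.integrable_toReal_rnDeriv
  have hgd : ∀ A : Set Ω, ∫ ω in A, g ω ∂(P + Q) = (Q A).toReal := fun A =>
    Measure.setIntegral_toReal_rnDeriv hac A
  refine ⟨(P + Q)[g | ⨆ t, (F t : MeasurableSpace Ω)], integrable_condExp, fun A hA => ?_, ?_⟩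
  · rw [setIntegral_condExp hle hgi hA, hgd]
  · have hcond : ∀ t, (fun ω => M t ω / (1 + M t ω)) =ᵐ[P + Q] (P + Q)[g | F t] := by
      intro t
      have hmeas : Measurable[F t] fun ω => M t ω / (1 + M t ω) :=
        (hM_meas t).div ((hM_meas t).const_add 1)
      have hint : Integrable (fun ω => M t ω / (1 + M t ω)) (P + Q) := by
        refine Integrable.of_bound (hmeas.mono (F.le t) le_rfl).aestronglyMeasurable 1
          (Eventually.of_forall fun ω => ?_)
        have h0 := hM_nonneg t ω
        rw [Real.norm_of_nonneg (by positivity), div_le_one (by linarith)]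
        linarith
      refine ae_eq_condExp_of_forall_setIntegral_eq (F.le t) hgi
        (fun _ _ _ => hint.integrableOn) (fun A hA _ => ?_)
        hmeas.stronglyMeasurable.aestronglyMeasurable
      rw [hgd, setIntegral_div_one_add_eq (F.le t) P Q (hM_meas t) (hM_nonneg t) (hM_int t)
        (hM_dens t) hA]
    filter_upwards [tendsto_ae_condExp (μ := P + Q) (ℱ := F) g, ae_all_iff.2 hcond] with ω h1 h2
    simpa only [h2] using h1

/-- Consequences of the Lebesgue decomposition of `Q` with respect to `P` on the limit σ-algebra:
`P` does not charge `{M_∞ = ∞}`, `Q` does not charge `{M_∞ = 0}`, `Q ≪ P` off `{M_∞ = ∞}` and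
`P ≪ Q` off `{M_∞ = 0}`. -/
lemma lebesgue_decomposition_limsup_density {Ω : Type*} {m : MeasurableSpace Ω}
    (F : Filtration ℕ m) (P Q : Measure Ω) [IsFiniteMeasure P] [IsFiniteMeasure Q]
    {M : ℕ → Ω → ℝ}
    (hM_meas : ∀ t, Measurable[F t] (M t)) (hM_nonneg : ∀ t ω, 0 ≤ M t ω)
    (hM_int : ∀ t, Integrable (M t) P)
    (hM_dens : ∀ t, ∀ A : Set Ω, MeasurableSet[F t] A →
      ∫ ω in A, M t ω ∂P = (Q A).toReal)
    {L : Ω → ℝ≥0∞} (hL : L = fun ω => limsup (fun t => ENNReal.ofReal (M t ω)) atTop) :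
    Measurable[⨆ t, (F t : MeasurableSpace Ω)] L ∧
      P {ω | L ω = ⊤} = 0 ∧ Q {ω | L ω = 0} = 0 ∧
      (∀ A : Set Ω, MeasurableSet[⨆ t, (F t : MeasurableSpace Ω)] A → P A = 0 →
        ∀ᵐ ω ∂Q, ω ∈ A → L ω = ⊤) ∧
      (∀ A : Set Ω, MeasurableSet[⨆ t, (F t : MeasurableSpace Ω)] A → Q A = 0 →
        ∀ᵐ ω ∂P, ω ∈ A → L ω = 0) := by
  have hle : ⨆ t, (F t : MeasurableSpace Ω) ≤ m := iSup_le F.le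
  have hLm : Measurable[⨆ t, (F t : MeasurableSpace Ω)] L := by
    rw [hL]
    exact Measurable.limsup fun t =>
      ((hM_meas t).mono (le_iSup (fun t => (F t : MeasurableSpace Ω)) t) le_rfl).ennreal_ofReal
  obtain ⟨Z, hZi, hZQ, hZ⟩ :=
    exists_density_tendsto_div_one_add F P Q hM_meas hM_nonneg hM_int hM_dens
  have hZP : ∀ A : Set Ω, MeasurableSet[⨆ t, (F t : MeasurableSpace Ω)] A →
      ∫ ω in A, (1 - Z ω) ∂(P + Q) = (P A).toReal := by
    intro A hA
    rw [integral_sub (integrable_const _) hZi.restrict, hZQ A hA]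
    simp [measureReal_def, ENNReal.toReal_add]
  have hZL : ∀ᵐ ω ∂(P + Q), 0 ≤ Z ω ∧ Z ω ≤ 1 ∧ (L ω = ⊤ ↔ Z ω = 1) ∧ (L ω = 0 ↔ Z ω = 0) := by
    filter_upwards [hZ] with ω h
    rw [hL]
    exact limsup_ofReal_of_tendsto_div_one_add (fun t => hM_nonneg t ω) h
  have hPac : P ≪ P + Q := Measure.absolutelyContinuous_of_le (Measure.le_add_right le_rfl)
  have hQac : Q ≪ P + Q := Measure.absolutelyContinuous_of_le (Measure.le_add_left le_rfl)
  have hset : ∀ c : ℝ≥0∞, MeasurableSet[⨆ t, (F t : MeasurableSpace Ω)] {ω | L ω = c} :=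
    fun c => hLm (measurableSet_singleton c)
  refine ⟨hLm, ?_, ?_, fun A hA hPA => ?_, fun A hA hQA => ?_⟩
  · have h := hZP _ (hset ⊤)
    rw [setIntegral_eq_zero_of_ae_eq_zero] at h
    · exact ((ENNReal.toReal_eq_zero_iff _).1 h.symm).resolve_right (measure_ne_top _ _)
    · filter_upwards [hZL] with ω hω hmem
      rw [hω.2.2.1.1 hmem, sub_self]
  · have h := hZQ _ (hset 0)
    rw [setIntegral_eq_zero_of_ae_eq_zero] at h
    · exact ((ENNReal.toReal_eq_zero_iff _).1 h.symm).resolve_right (measure_ne_top _ _)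
    · filter_upwards [hZL] with ω hω hmem
      exact hω.2.2.2.1 hmem
  · have h := hZP A hA
    rw [hPA, ENNReal.toReal_zero, setIntegral_eq_zero_iff_of_nonneg_ae
      (ae_restrict_of_ae (hZL.mono fun ω hω => sub_nonneg.2 hω.2.1))
      ((integrable_const _).sub hZi).integrableOn] at h
    filter_upwards [hQac.ae_le hZL, hQac.ae_le ((ae_restrict_iff' (hle A hA)).1 h)] with ω h1 h2 hω
    exact h1.2.2.1.2 (sub_eq_zero.1 (h2 hω)).symm
  · have h := hZQ A hA
    rw [hQA, ENNReal.toReal_zero, setIntegral_eq_zero_iff_of_nonneg_ae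
      (ae_restrict_of_ae (hZL.mono fun ω hω => hω.1)) hZi.integrableOn] at h
    filter_upwards [hPac.ae_le hZL, hPac.ae_le ((ae_restrict_iff' (hle A hA)).1 h)] with ω h1 h2 hω
    exact h1.2.2.2.2 (h2 hω)

/-- **Characterization of a strictly positive mass at infinity (Lemma on `γ_∞`).**
Let `Q` be locally absolutely continuous with respect to `P`, with density process `M`,
and let `M_∞ := limsup_t M_t` (as a `[0,∞]`-valued function).  Let `γ_∞` be a nonnegative
`ℱ_∞`-measurable function vanishing `Q`-a.s. on `{M_∞ = ∞}`.  Then `γ_∞ > 0` `Q`-a.s. if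
and only if `Q ≪ P` on `ℱ_∞` and `γ_∞ > 0` `P`-a.s. on `{M_∞ > 0}`. -/
theorem stmt_19 {Ω : Type*} {m : MeasurableSpace Ω} (F : Filtration ℕ m)
    (P Q : Measure Ω) [IsProbabilityMeasure P] [IsProbabilityMeasure Q]
    (hQP : ∀ t, ∀ A : Set Ω, MeasurableSet[F t] A → P A = 0 → Q A = 0)
    (M : ℕ → Ω → ℝ)
    (hM_meas : ∀ t, Measurable[F t] (M t)) (hM_nonneg : ∀ t ω, 0 ≤ M t ω)
    (hM_dens : ∀ t, ∀ A : Set Ω, MeasurableSet[F t] A →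
      ∫ ω in A, M t ω ∂P = (Q A).toReal)
    (γinf : Ω → ℝ)
    (hγ_meas : Measurable[⨆ t, (F t : MeasurableSpace Ω)] γinf)
    (hγ_nonneg : ∀ ω, 0 ≤ γinf ω)
    (hγ_sing : ∀ᵐ ω ∂Q,
      limsup (fun t => ENNReal.ofReal (M t ω)) atTop = ⊤ → γinf ω = 0) :
    (∀ᵐ ω ∂Q, 0 < γinf ω) ↔
      ((∀ A : Set Ω, MeasurableSet[⨆ t, (F t : MeasurableSpace Ω)] A → P A = 0 → Q A = 0) ∧
        ∀ᵐ ω ∂P,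
          0 < limsup (fun t => ENNReal.ofReal (M t ω)) atTop → 0 < γinf ω) := by
  have hM_int : ∀ t, Integrable (M t) P := fun t => by
    by_contra h
    have h1 := hM_dens t Set.univ MeasurableSet.univ
    rw [Measure.restrict_univ, integral_undef h] at h1
    simp at h1
  obtain ⟨hLm, hPtop, hQ0, hQP_fin, hPQ_pos⟩ :=
    lebesgue_decomposition_limsup_density F P Q hM_meas hM_nonneg hM_int hM_dens rfl
  have hγset : MeasurableSet[⨆ t, (F t : MeasurableSpace Ω)] {ω | γinf ω ≤ 0} :=
    hγ_meas measurableSet_Iic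
  constructor
  · intro hpos
    refine ⟨fun A hA hPA => ?_, ?_⟩
    · rw [measure_eq_zero_iff_ae_notMem]
      filter_upwards [hpos, hγ_sing, hQP_fin A hA hPA] with ω h1 h2 h3 hω
      exact h1.ne' (h2 (h3 hω))
    · have hQγ : Q {ω | γinf ω ≤ 0} = 0 := by
        rw [measure_eq_zero_iff_ae_notMem]
        filter_upwards [hpos] with ω h using not_le.2 h
      filter_upwards [hPQ_pos _ hγset hQγ] with ω h hL
      by_contra hneg
      exact hL.ne' (h (not_lt.1 hneg))
  · rintro ⟨hac, hpos⟩
    have hP : P ({ω | γinf ω ≤ 0} ∩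
        {ω | limsup (fun t => ENNReal.ofReal (M t ω)) atTop = 0}ᶜ) = 0 := by
      rw [measure_eq_zero_iff_ae_notMem]
      filter_upwards [hpos] with ω h hω
      exact (h (pos_iff_ne_zero.2 hω.2)).not_ge hω.1
    have hQ := hac _ (hγset.inter (hLm (measurableSet_singleton 0)).compl) hP
    rw [measure_eq_zero_iff_ae_notMem] at hQ hQ0
    filter_upwards [hQ, hQ0] with ω h1 h2
    by_contra hneg
    exact h1 ⟨not_lt.1 hneg, h2⟩
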